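/- arXiv:1202.2071 — 2 statements merged into one kernel-verified Lean document; each statement's English description precedes it below -/
import Mathlib

section
/- Let v : ℝ → ℝ be continuously differentiable and 1-periodic with ∫₀¹ v(x) dx = 0. Then sup_{x ∈ ℝ} v(x)² ≤ (∫₀¹ v(x)² dx)^{1/2} · (∫₀¹ v'(x)² dx)^{1/2}. -/
open MeasureTheory intervalIntegral

/-- The Cauchy–Schwarz inequality for continuous functions on an interval. -/
theorem integral_abs_mul_le_L2_mul_L2 {f g : ℝ → ℝ} (hf : Continuous f) (hg : Continuous g)
    {a b : ℝ} (hab : a ≤ b) :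
    ∫ x in a..b, |f x * g x| ≤
      (∫ x in a..b, (f x) ^ 2) ^ ((1:ℝ)/2) * (∫ x in a..b, (g x) ^ 2) ^ ((1:ℝ)/2) := by
  have memLp {h : ℝ → ℝ} (hh : Continuous h) :
      MemLp (fun x ↦ |h x|) (ENNReal.ofReal 2) (volume.restrict (Set.Ioc a b)) := by
    rw [ENNReal.ofReal_ofNat, memLp_two_iff_integrable_sq hh.abs.aestronglyMeasurable]
    exact (hh.abs.pow 2).integrableOn_Ioc
  have key := integral_mul_le_Lp_mul_Lq_of_nonneg Real.HolderConjugate.two_two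
    (Filter.Eventually.of_forall fun x ↦ abs_nonneg (f x))
    (Filter.Eventually.of_forall fun x ↦ abs_nonneg (g x)) (memLp hf) (memLp hg)
  simp only [integral_of_le hab, abs_mul]
  simpa only [Real.rpow_two, sq_abs] using key

/-- A continuous function with zero mean on a nontrivial interval vanishes somewhere. -/
theorem exists_eq_zero_of_intervalIntegral_eq_zero {f : ℝ → ℝ} (hf : Continuous f) {a b : ℝ}
    (hab : a < b) (h : ∫ x in a..b, f x = 0) : ∃ z, f z = 0 := by
  have hd (x : ℝ) : HasDerivAt (fun u ↦ ∫ t in a..u, f t) (f x) x :=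
    hf.integral_hasStrictDerivAt a x |>.hasDerivAt
  obtain ⟨z, -, hz⟩ := exists_hasDerivAt_eq_zero hab
    (fun x _ ↦ (hd x).continuousAt.continuousWithinAt) (by simp [h]) (fun x _ ↦ hd x)
  exact ⟨z, hz⟩

/-- If a `C¹` function vanishes at both endpoints of an interval, then its square there is bounded
by the integral of `|v v'|`. -/
theorem sq_le_integral_abs_mul_deriv {v : ℝ → ℝ} (hv : ContDiff ℝ 1 v) {a b y : ℝ}
    (ha : v a = 0) (hb : v b = 0) (hay : a ≤ y) (hyb : y ≤ b) :
    (v y) ^ 2 ≤ ∫ x in a..b, |v x * deriv v x| := by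
  have hcont : Continuous fun x ↦ v x * deriv v x :=
    hv.continuous.mul (hv.continuous_deriv le_rfl)
  have ftc (c d : ℝ) : ∫ x in c..d, 2 * (v x * deriv v x) = (v d) ^ 2 - (v c) ^ 2 := by
    refine integral_eq_sub_of_hasDerivAt (f := fun x ↦ (v x) ^ 2) (fun x _ ↦ ?_)
      ((hcont.const_mul 2).intervalIntegrable c d)
    exact ((hv.differentiable one_ne_zero x).hasDerivAt.pow 2).congr_deriv (by push_cast; ring)
  have h₁ := ftc a y
  have h₂ := ftc y b
  rw [intervalIntegral.integral_const_mul] at h₁ h₂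
  have h₃ := abs_le.mp (abs_integral_le_integral_abs (f := fun x ↦ v x * deriv v x)
    (μ := volume) hay)
  have h₄ := abs_le.mp (abs_integral_le_integral_abs (f := fun x ↦ v x * deriv v x)
    (μ := volume) hyb)
  rw [← integral_add_adjacent_intervals (hcont.abs.intervalIntegrable a y)
    (hcont.abs.intervalIntegrable y b)]
  rw [ha] at h₁
  rw [hb] at h₂
  linarith [h₃.2, h₄.1]

/-- Interpolation inequality `‖v‖_{L^∞}² ≤ ‖v‖_{L²} ‖v'‖_{L²}` on the unit circle
for mean-zero `C¹` 1-periodic functions. -/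
theorem sup_sq_le_L2_mul_L2_deriv (v : ℝ → ℝ)
    (hv : ContDiff ℝ 1 v)
    (hper : ∀ x : ℝ, v (x + 1) = v x)
    (hmean : (∫ x in (0:ℝ)..1, v x) = 0) :
    ∀ x : ℝ, (v x) ^ 2 ≤
      (∫ x in (0:ℝ)..1, (v x) ^ 2) ^ ((1:ℝ)/2) *
      (∫ x in (0:ℝ)..1, (deriv v x) ^ 2) ^ ((1:ℝ)/2) := by
  intro x
  obtain ⟨z, hz⟩ := exists_eq_zero_of_intervalIntegral_eq_zero hv.continuous one_pos hmean
  obtain ⟨y, ⟨hzy, hyz⟩, hxy⟩ := Function.Periodic.exists_mem_Ico hper one_pos x z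
  have hper' : Function.Periodic (fun x ↦ |v x * deriv v x|) 1 := fun t ↦ by
    have hd : deriv v (t + 1) = deriv v t := by
      rw [← deriv_comp_add_const, funext hper]
    simp only [hper, hd]
  calc (v x) ^ 2 = (v y) ^ 2 := by rw [hxy]
    _ ≤ ∫ t in z..z + 1, |v t * deriv v t| :=
      sq_le_integral_abs_mul_deriv hv hz ((hper z).trans hz) hzy hyz.le
    _ = ∫ t in (0:ℝ)..1, |v t * deriv v t| := by
      simpa using hper'.intervalIntegral_add_eq z 0
    _ ≤ _ := integral_abs_mul_le_L2_mul_L2 hv.continuous (hv.continuous_deriv le_rfl) zero_le_one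
end

section
/- Let T > 0 and let u : ℝ × [0,T] → ℝ be 1-periodic in x, three times continuously differentiable in x and once in t, satisfy the viscous Burgers equation ∂_t u + 2u ∂_x u = ∂_x² u, and assume E(t) := (1/2)∫_{-1/2}^{1/2} (∂_x u(x,t))² dx > 0 for all t ∈ [0,T]. Define K(t) = (1/2)∫_{-1/2}^{1/2} u(x,t)² dx. Then E(T)^{1/3} - E(0)^{1/3} ≤ (1/2)∫₀^T E(t) dt = (1/4)(K(0) - K(T)). -/
open MeasureTheory intervalIntegral Set

/-- A continuous function that is `1`-periodic in space is bounded on compact time intervals. -/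
theorem exists_bound_of_periodic {F : ℝ → ℝ → ℝ} (hF : Continuous fun p : ℝ × ℝ => F p.1 p.2)
    (hper : ∀ x t, F (x + 1) t = F x t) (a b : ℝ) :
    ∃ C, ∀ x, ∀ t ∈ Icc a b, |F x t| ≤ C := by
  obtain ⟨C, hC⟩ := ((isCompact_Icc (a := (0 : ℝ)) (b := 1)).prod
    (isCompact_Icc (a := a) (b := b))).exists_bound_of_continuousOn hF.continuousOn
  refine ⟨C, fun x t ht => ?_⟩
  have hp : Function.Periodic (fun y => F y t) 1 := fun y => hper y t
  obtain ⟨y, hy, hxy⟩ := hp.exists_mem_Ico₀ one_pos x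
  rw [hxy]
  exact hC (y, t) ⟨⟨hy.1, hy.2.le⟩, ht⟩

/-- At a global maximum the second derivative is nonpositive. -/
theorem second_deriv_nonpos_of_isMax {f f' : ℝ → ℝ} {f'' x : ℝ}
    (hf : ∀ y, HasDerivAt f (f' y) y) (hf' : HasDerivAt f' f'' x) (hmax : ∀ y, f y ≤ f x) :
    f'' ≤ 0 := by
  by_contra! hpos
  have hd : deriv f = f' := funext fun y => (hf y).deriv
  have hmax' : IsLocalMax f x := Filter.Eventually.of_forall hmax
  have hmin : IsLocalMin f x := by
    apply isLocalMin_of_deriv_deriv_pos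
    · rwa [hd, hf'.deriv]
    · exact hmax'.deriv_eq_zero
    · exact (hf x).continuousAt
  have hconst : f =ᶠ[nhds x] fun _ => f x := by
    filter_upwards [hmin] with y hy using le_antisymm (hmax y) hy
  have hzero : f' =ᶠ[nhds x] fun _ => 0 := by
    have := hconst.deriv
    rw [hd] at this
    simpa using this
  have := hf'.deriv
  rw [hzero.deriv_eq] at this
  simp at this
  linarith

/-- If `f` is maximal at `t` among earlier times, its derivative at `t` is nonnegative. -/
theorem deriv_nonneg_of_isMax_left {f : ℝ → ℝ} {f' a t : ℝ} (hat : a < t)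
    (hf : HasDerivAt f f' t) (hmax : ∀ s ∈ Icc a t, f s ≤ f t) : 0 ≤ f' := by
  have h := (hasDerivAt_iff_tendsto_slope.1 hf).mono_left
    (nhdsWithin_mono t (fun s (hs : s ∈ Iio t) => ne_of_lt hs))
  refine ge_of_tendsto h ?_
  filter_upwards [Ico_mem_nhdsLT hat] with s hs
  rw [slope_def_field]
  exact div_nonneg_of_nonpos (by linarith [hmax s ⟨hs.1, hs.2.le⟩]) (by linarith [hs.2])

/-- Maximum principle for a periodic subsolution `W_t ≤ W_xx + M W`, where the inequality is only
required at positive spatially critical points. -/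
theorem parabolic_max_principle {T M : ℝ} {W Wx Wxx Wt : ℝ → ℝ → ℝ}
    (hW : Continuous fun p : ℝ × ℝ => W p.1 p.2)
    (hper : ∀ x t, W (x + 1) t = W x t) (h0 : ∀ x, W x 0 ≤ 0)
    (hx : ∀ x, ∀ t ∈ Ioo 0 T, HasDerivAt (fun y => W y t) (Wx x t) x)
    (hxx : ∀ x, ∀ t ∈ Ioo 0 T, HasDerivAt (fun y => Wx y t) (Wxx x t) x)
    (ht : ∀ x, ∀ t ∈ Ioo 0 T, HasDerivAt (fun s => W x s) (Wt x t) t)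
    (hle : ∀ x, ∀ t ∈ Ioo 0 T, Wx x t = 0 → 0 < W x t → Wt x t ≤ Wxx x t + M * W x t) :
    ∀ x, ∀ t ∈ Ico 0 T, W x t ≤ 0 := by
  intro x t htT
  by_contra! hpos
  have hcont : Continuous fun p : ℝ × ℝ => Real.exp (-(M + 1) * p.2) * W p.1 p.2 := by fun_prop
  obtain ⟨p, hp, hpmax⟩ := ((isCompact_Icc (a := (0 : ℝ)) (b := 1)).prod
    (isCompact_Icc (a := 0) (b := t))).exists_isMaxOn
    ⟨(0, 0), by simp [htT.1]⟩ hcont.continuousOn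
  obtain ⟨x₀, t₀⟩ := p
  have hmax : ∀ y, ∀ s ∈ Icc 0 t, Real.exp (-(M + 1) * s) * W y s ≤
      Real.exp (-(M + 1) * t₀) * W x₀ t₀ := by
    intro y s hs
    have hpy : Function.Periodic (fun y => W y s) 1 := fun y => hper y s
    obtain ⟨z, hz, hyz⟩ := hpy.exists_mem_Ico₀ one_pos y
    rw [hyz]
    exact hpmax (show (z, s) ∈ Icc (0 : ℝ) 1 ×ˢ Icc 0 t from ⟨⟨hz.1, hz.2.le⟩, hs⟩)
  have hW₀ : 0 < W x₀ t₀ := by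
    have h1 : 0 < Real.exp (-(M + 1) * t) * W x t := by positivity
    have h2 := hmax x t ⟨htT.1, le_rfl⟩
    exact pos_of_mul_pos_right (h1.trans_le h2) (Real.exp_pos _).le
  have ht₀ : 0 < t₀ := by
    rcases hp.2.1.lt_or_eq with h | h
    · exact h
    · simp only at h
      rw [← h] at hW₀
      linarith [h0 x₀]
  have ht₀T : t₀ ∈ Ioo 0 T := ⟨ht₀, hp.2.2.trans_lt htT.2⟩
  have hxmax : ∀ y, W y t₀ ≤ W x₀ t₀ := fun y =>
    le_of_mul_le_mul_left (hmax y t₀ hp.2) (Real.exp_pos _)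
  have hxz : Wx x₀ t₀ = 0 :=
    IsLocalMax.hasDerivAt_eq_zero (f := fun y => W y t₀) (Filter.Eventually.of_forall hxmax)
      (hx x₀ t₀ ht₀T)
  have hxxle : Wxx x₀ t₀ ≤ 0 :=
    second_deriv_nonpos_of_isMax (f := fun y => W y t₀) (fun y => hx y t₀ ht₀T)
      (hxx x₀ t₀ ht₀T) hxmax
  have hexp : HasDerivAt (fun s => Real.exp (-(M + 1) * s))
      (Real.exp (-(M + 1) * t₀) * (-(M + 1))) t₀ := by
    simpa using ((hasDerivAt_id t₀).const_mul (-(M + 1))).exp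
  have htd := deriv_nonneg_of_isMax_left ht₀ (hexp.mul (ht x₀ t₀ ht₀T))
    (fun s hs => hmax x₀ s ⟨hs.1, hs.2.trans hp.2.2⟩)
  have hle₀ := hle x₀ t₀ ht₀T hxz hW₀
  have hfac : 0 ≤ Real.exp (-(M + 1) * t₀) * (Wt x₀ t₀ - (M + 1) * W x₀ t₀) := by linarith
  have := nonneg_of_mul_nonneg_right hfac (Real.exp_pos _)
  linarith

/-- The Gaussian average of `f`, which solves `G_t = G_xx - 2 m G_x` up to normalization of the
initial value. -/
noncomputable def heatAverage (m : ℝ) (f : ℝ → ℝ) (x t : ℝ) : ℝ :=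
  ∫ z : ℝ, Real.exp (-z ^ 2) * f (x - 2 * m * t + 2 * √t * z)

theorem integrable_exp_neg_sq : Integrable fun z : ℝ => Real.exp (-z ^ 2) := by
  simpa using integrable_exp_neg_mul_sq one_pos

theorem integrable_abs_mul_exp_neg_sq : Integrable fun z : ℝ => |z| * Real.exp (-z ^ 2) := by
  have h := (integrable_mul_exp_neg_mul_sq one_pos).norm
  simpa [abs_mul, Real.abs_exp] using h

theorem integrable_exp_neg_sq_mul {g : ℝ → ℝ} (hg : Continuous g) {C : ℝ} (hC : ∀ y, |g y| ≤ C) :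
    Integrable fun z : ℝ => Real.exp (-z ^ 2) * g z :=
  integrable_exp_neg_sq.mul_bdd hg.aestronglyMeasurable (Filter.Eventually.of_forall hC)

theorem continuous_heatAverage (m : ℝ) {f : ℝ → ℝ} (hf : Continuous f) {C : ℝ}
    (hC : ∀ y, |f y| ≤ C) : Continuous fun p : ℝ × ℝ => heatAverage m f p.1 p.2 := by
  unfold heatAverage
  refine continuous_of_dominated (bound := fun z => Real.exp (-z ^ 2) * C)
    (fun p => by fun_prop) (fun p => ?_) (integrable_exp_neg_sq.mul_const C) ?_
  · refine Filter.Eventually.of_forall fun z => ?_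
    rw [norm_mul, Real.norm_eq_abs, Real.abs_exp, Real.norm_eq_abs]
    exact mul_le_mul_of_nonneg_left (hC _) (Real.exp_pos _).le
  · exact Filter.Eventually.of_forall fun z => by fun_prop

theorem heatAverage_periodic (m : ℝ) {f : ℝ → ℝ} (hf : ∀ y, f (y + 1) = f y) (x t : ℝ) :
    heatAverage m f (x + 1) t = heatAverage m f x t := by
  unfold heatAverage
  congr 1
  ext z
  rw [← hf (x - 2 * m * t + 2 * √t * z)]
  ring_nf

theorem heatAverage_zero (m : ℝ) (f : ℝ → ℝ) (x : ℝ) :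
    heatAverage m f x 0 = (∫ z : ℝ, Real.exp (-z ^ 2)) * f x := by
  simp [heatAverage, MeasureTheory.integral_mul_const]

theorem heatAverage_pos (m : ℝ) {f : ℝ → ℝ} (hf : Continuous f) {C : ℝ}
    (hC : ∀ y, |f y| ≤ C) (hpos : ∀ y, 0 < f y) (x t : ℝ) : 0 < heatAverage m f x t := by
  unfold heatAverage
  have hp : ∀ z : ℝ, 0 < Real.exp (-z ^ 2) * f (x - 2 * m * t + 2 * √t * z) :=
    fun z => mul_pos (Real.exp_pos _) (hpos _)
  rw [integral_pos_iff_support_of_nonneg (fun z => (hp z).le)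
    (integrable_exp_neg_sq_mul (g := fun z => f (x - 2 * m * t + 2 * √t * z))
      (by fun_prop) (fun z => hC _))]
  have : (Function.support fun z : ℝ => Real.exp (-z ^ 2) * f (x - 2 * m * t + 2 * √t * z)) =
      univ := eq_univ_of_forall fun z => (hp z).ne'
  rw [this]
  simp

theorem hasDerivAt_heatAverage_space (m : ℝ) {f f' : ℝ → ℝ} (hf : ∀ y, HasDerivAt f (f' y) y)
    (hf' : Continuous f') {C C' : ℝ} (hC : ∀ y, |f y| ≤ C) (hC' : ∀ y, |f' y| ≤ C') (x t : ℝ) :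
    HasDerivAt (fun y => heatAverage m f y t) (heatAverage m f' x t) x := by
  have hfc : Continuous f := continuous_iff_continuousAt.2 fun y => (hf y).continuousAt
  unfold heatAverage
  refine (hasDerivAt_integral_of_dominated_loc_of_deriv_le
    (F := fun y z => Real.exp (-z ^ 2) * f (y - 2 * m * t + 2 * √t * z))
    (F' := fun y z => Real.exp (-z ^ 2) * f' (y - 2 * m * t + 2 * √t * z))
    (bound := fun z => Real.exp (-z ^ 2) * C') Filter.univ_mem
    (Filter.Eventually.of_forall fun y => by fun_prop)
    (integrable_exp_neg_sq_mul (g := fun z => f (x - 2 * m * t + 2 * √t * z))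
      (by fun_prop) (fun z => hC _)) (by fun_prop) ?_ (integrable_exp_neg_sq.mul_const C') ?_).2
  · refine Filter.Eventually.of_forall fun z y _ => ?_
    rw [norm_mul, Real.norm_eq_abs, Real.abs_exp, Real.norm_eq_abs]
    exact mul_le_mul_of_nonneg_left (hC' _) (Real.exp_pos _).le
  · refine Filter.Eventually.of_forall fun z y _ => ?_
    have h := (hf (y - 2 * m * t + 2 * √t * z)).comp y
      (((hasDerivAt_id y).sub_const (2 * m * t)).add_const (2 * √t * z))
    simpa using h.const_mul (Real.exp (-z ^ 2))

/-- Gaussian integration by parts. -/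
theorem integral_mul_exp_neg_sq_mul {g g' : ℝ → ℝ} (hg : ∀ y, HasDerivAt g (g' y) y)
    (hg' : Continuous g') {C C' : ℝ} (hC : ∀ y, |g y| ≤ C) (hC' : ∀ y, |g' y| ≤ C') :
    Integrable (fun z : ℝ => Real.exp (-z ^ 2) * (z * g z)) ∧
    ∫ z : ℝ, Real.exp (-z ^ 2) * (z * g z) = (1 / 2) * ∫ z : ℝ, Real.exp (-z ^ 2) * g' z := by
  have hgc : Continuous g := continuous_iff_continuousAt.2 fun y => (hg y).continuousAt
  have hexp : ∀ z : ℝ, HasDerivAt (fun z : ℝ => Real.exp (-z ^ 2))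
      (Real.exp (-z ^ 2) * (-(2 * z))) z := by
    intro z
    simpa using ((hasDerivAt_pow 2 z).neg).exp
  have hint : Integrable (fun z : ℝ => Real.exp (-z ^ 2) * (z * g z)) := by
    refine (integrable_abs_mul_exp_neg_sq.mul_const C).mono' (by fun_prop)
      (Filter.Eventually.of_forall fun z => ?_)
    rw [norm_mul, norm_mul, Real.norm_eq_abs, Real.abs_exp, Real.norm_eq_abs, Real.norm_eq_abs]
    nlinarith [mul_le_mul_of_nonneg_left (hC z)
      (mul_nonneg (abs_nonneg z) (Real.exp_pos (-z ^ 2)).le)]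
  refine ⟨hint, ?_⟩
  have h := integral_mul_deriv_eq_deriv_mul_of_integrable (fun z _ => hexp z) (fun z _ => hg z)
    (integrable_exp_neg_sq_mul hg' hC')
    ((hint.const_mul (-2)).congr (Filter.Eventually.of_forall fun z => by
      simp only [Pi.mul_apply]; ring)) (integrable_exp_neg_sq_mul hgc hC)
  have h2 : ∫ z : ℝ, Real.exp (-z ^ 2) * (-(2 * z)) * g z =
      -2 * ∫ z : ℝ, Real.exp (-z ^ 2) * (z * g z) := by
    rw [← MeasureTheory.integral_const_mul]
    congr 1
    ext z
    ring
  rw [h2] at h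
  linarith

theorem hasDerivAt_heatAverage_time (m : ℝ) {f f' f'' : ℝ → ℝ} (hf : ∀ y, HasDerivAt f (f' y) y)
    (hf' : ∀ y, HasDerivAt f' (f'' y) y) (hf'' : Continuous f'') {C C' C'' : ℝ}
    (hC : ∀ y, |f y| ≤ C) (hC' : ∀ y, |f' y| ≤ C') (hC'' : ∀ y, |f'' y| ≤ C'') (x : ℝ) {t : ℝ}
    (ht : 0 < t) :
    HasDerivAt (fun s => heatAverage m f x s)
      (heatAverage m f'' x t - 2 * m * heatAverage m f' x t) t := by
  have hfc : Continuous f := continuous_iff_continuousAt.2 fun y => (hf y).continuousAt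
  have hfc' : Continuous f' := continuous_iff_continuousAt.2 fun y => (hf' y).continuousAt
  have hs : Ioi (t / 2) ∈ nhds t := Ioi_mem_nhds (by linarith)
  have hder := (hasDerivAt_integral_of_dominated_loc_of_deriv_le (μ := volume)
    (F := fun s z => Real.exp (-z ^ 2) * f (x - 2 * m * s + 2 * √s * z))
    (F' := fun s z => Real.exp (-z ^ 2) * (f' (x - 2 * m * s + 2 * √s * z) *
      (-(2 * m) + z / √s)))
    (bound := fun z => C' * (2 * |m|) * Real.exp (-z ^ 2) +
      C' / √(t / 2) * (|z| * Real.exp (-z ^ 2))) hs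
    (Filter.Eventually.of_forall fun y => by fun_prop)
    (integrable_exp_neg_sq_mul (g := fun z => f (x - 2 * m * t + 2 * √t * z))
      (by fun_prop) (fun z => hC _)) (by fun_prop) ?_
      ((integrable_exp_neg_sq.const_mul _).add (integrable_abs_mul_exp_neg_sq.const_mul _)) ?_).2
  · have hst : 0 < √t := Real.sqrt_pos.2 ht
    have hparts := integral_mul_exp_neg_sq_mul
      (g := fun z => f' (x - 2 * m * t + 2 * √t * z))
      (g' := fun z => 2 * √t * f'' (x - 2 * m * t + 2 * √t * z)) (C := C')
      (C' := 2 * √t * C'') (fun z => by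
        have h := (hf' (x - 2 * m * t + 2 * √t * z)).comp z
          (((hasDerivAt_id z).const_mul (2 * √t)).const_add (x - 2 * m * t))
        exact h.congr_deriv (by simp [mul_comm])) (by fun_prop) (fun z => hC' _) (fun z => by
        rw [abs_mul, abs_of_pos (by positivity : 0 < 2 * √t)]
        exact mul_le_mul_of_nonneg_left (hC'' _) (by positivity))
    have hint := integrable_exp_neg_sq_mul (g := fun z => f' (x - 2 * m * t + 2 * √t * z))
      (by fun_prop) (fun z => hC' _)
    unfold heatAverage
    refine hder.congr_deriv ?_
    symm
    have h1 : ∫ z : ℝ, Real.exp (-z ^ 2) * (2 * √t * f'' (x - 2 * m * t + 2 * √t * z)) =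
        2 * √t * ∫ z : ℝ, Real.exp (-z ^ 2) * f'' (x - 2 * m * t + 2 * √t * z) := by
      rw [← MeasureTheory.integral_const_mul]
      congr 1
      ext z
      ring
    have h2 : ∀ z : ℝ, Real.exp (-z ^ 2) * (f' (x - 2 * m * t + 2 * √t * z) *
        (-(2 * m) + z / √t)) =
        -(2 * m) * (Real.exp (-z ^ 2) * f' (x - 2 * m * t + 2 * √t * z)) +
        (√t)⁻¹ * (Real.exp (-z ^ 2) * (z * f' (x - 2 * m * t + 2 * √t * z))) := by
      intro z
      ring
    rw [integral_congr_ae (Filter.Eventually.of_forall h2),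
      MeasureTheory.integral_add (hint.const_mul _) (hparts.1.const_mul _),
      MeasureTheory.integral_const_mul, MeasureTheory.integral_const_mul, hparts.2, h1]
    generalize ∫ z : ℝ, Real.exp (-z ^ 2) * f'' (x - 2 * m * t + 2 * √t * z) = J
    generalize ∫ z : ℝ, Real.exp (-z ^ 2) * f' (x - 2 * m * t + 2 * √t * z) = J'
    field_simp
    ring
  · refine Filter.Eventually.of_forall fun z s hs => ?_
    have hs' : t / 2 < s := hs
    have hq : 0 < √(t / 2) := Real.sqrt_pos.2 (by linarith)
    have hle : √(t / 2) ≤ √s := Real.sqrt_le_sqrt hs'.le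
    have hC'0 : 0 ≤ C' := (abs_nonneg _).trans (hC' 0)
    have h1 : |-(2 * m) + z / √s| ≤ 2 * |m| + |z| / √(t / 2) := by
      refine (abs_add_le _ _).trans (add_le_add ?_ ?_)
      · simp [abs_mul]
      · rw [abs_div, abs_of_nonneg (Real.sqrt_nonneg s)]
        gcongr
    rw [norm_mul, norm_mul, Real.norm_eq_abs, Real.abs_exp, Real.norm_eq_abs, Real.norm_eq_abs]
    calc Real.exp (-z ^ 2) * (|f' (x - 2 * m * s + 2 * √s * z)| * |-(2 * m) + z / √s|)
        ≤ Real.exp (-z ^ 2) * (C' * (2 * |m| + |z| / √(t / 2))) := by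
          gcongr
          exact hC' _
      _ = _ := by ring
  · refine Filter.Eventually.of_forall fun z s hs => ?_
    have hs' : 0 < s := by
      have : t / 2 < s := hs
      linarith
    have hsq : HasDerivAt (fun s => x - 2 * m * s + 2 * √s * z) (-(2 * m) + z / √s) s := by
      have h := ((((hasDerivAt_id s).const_mul (2 * m)).const_sub x).add
        (((Real.hasDerivAt_sqrt hs'.ne').const_mul 2).mul_const z))
      refine h.congr_deriv ?_
      have : 0 < √s := Real.sqrt_pos.2 hs'
      field_simp
    exact ((hf _).comp s hsq).const_mul _

theorem deriv_add_one_of_periodic {f : ℝ → ℝ} (hf : ∀ y, f (y + 1) = f y) (y : ℝ) :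
    deriv f (y + 1) = deriv f y := by
  rw [← deriv_comp_add_const]
  simp only [hf]

theorem hasDerivAt_deriv_of_contDiff {f : ℝ → ℝ} {n : WithTop ℕ∞} (hf : ContDiff ℝ n f)
    (hn : 2 ≤ n) (x : ℝ) :
    HasDerivAt f (deriv f x) x ∧ HasDerivAt (deriv f) (deriv (deriv f) x) x := by
  have h2 : ContDiff ℝ (1 + 1) f := hf.of_le (by simpa [one_add_one_eq_two] using hn)
  exact ⟨(h2.differentiable (by norm_num) x).hasDerivAt,
    ((contDiff_succ_iff_deriv.1 h2).2.2.differentiable (by norm_num) x).hasDerivAt⟩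

theorem continuous_deriv_deriv_of_contDiff {f : ℝ → ℝ} {n : WithTop ℕ∞} (hf : ContDiff ℝ n f)
    (hn : 2 ≤ n) : Continuous (deriv (deriv f)) := by
  have h2 : ContDiff ℝ (1 + 1) f := hf.of_le (by simpa [one_add_one_eq_two] using hn)
  exact (contDiff_succ_iff_deriv.1 h2).2.2.continuous_deriv (by norm_num)

/-- The Cole-Hopf transform `f = exp (-∫ q)` of a periodic mean-zero function `q`. -/
theorem exists_coleHopf_initial {q : ℝ → ℝ} (hq : ContDiff ℝ 3 q) (hper : ∀ y, q (y + 1) = q y)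
    (hmean : ∫ y in (0 : ℝ)..1, q y = 0) :
    ∃ (f f₁ f₂ f₃ : ℝ → ℝ) (C : ℝ), (∀ y, HasDerivAt f (f₁ y) y) ∧ (∀ y, HasDerivAt f₁ (f₂ y) y) ∧
      (∀ y, HasDerivAt f₂ (f₃ y) y) ∧ Continuous f₃ ∧
      (∀ y, |f y| ≤ C) ∧ (∀ y, |f₁ y| ≤ C) ∧ (∀ y, |f₂ y| ≤ C) ∧ (∀ y, |f₃ y| ≤ C) ∧
      (∀ y, f (y + 1) = f y) ∧ (∀ y, f₁ (y + 1) = f₁ y) ∧ (∀ y, f₂ (y + 1) = f₂ y) ∧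
      (∀ y, 0 < f y) ∧ ∀ y, f₁ y = -q y * f y := by
  have hq₀ : Continuous q := hq.continuous
  have hq₂ : Continuous (deriv (deriv q)) := continuous_deriv_deriv_of_contDiff hq (by norm_num)
  have hd := hasDerivAt_deriv_of_contDiff hq (by norm_num)
  have hq₁ : Continuous (deriv q) := continuous_iff_continuousAt.2 fun y => (hd y).2.continuousAt
  have hper₁ := deriv_add_one_of_periodic hper
  have hper₂ := deriv_add_one_of_periodic hper₁
  set f : ℝ → ℝ := fun x => Real.exp (-∫ y in (0 : ℝ)..x, q y) with hf_def
  have hf : ∀ y, HasDerivAt f (-q y * f y) y := fun y => by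
    have h := (integral_hasDerivAt_right (hq₀.intervalIntegrable 0 y)
      (hq₀.stronglyMeasurableAtFilter _ _) hq₀.continuousAt).neg.exp
    exact h.congr_deriv (mul_comm _ _)
  have hfper : ∀ y, f (y + 1) = f y := fun y => by
    have hp : Function.Periodic q 1 := hper
    have h := hp.intervalIntegral_add_eq 0 y
    simp only [hf_def]
    rw [← integral_add_adjacent_intervals (hq₀.intervalIntegrable 0 y)
      (hq₀.intervalIntegrable y (y + 1)), ← h, zero_add, hmean, add_zero]
  have hf₁ : ∀ y, HasDerivAt (fun y => -q y * f y) ((-deriv q y + q y ^ 2) * f y) y := fun y =>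
    ((hd y).1.neg.mul (hf y)).congr_deriv (by simp only [Pi.neg_apply]; ring)
  have hf₂ : ∀ y, HasDerivAt (fun y => (-deriv q y + q y ^ 2) * f y)
      ((-deriv (deriv q) y + 3 * q y * deriv q y - q y ^ 3) * f y) y := fun y =>
    (((hd y).2.neg.add ((hd y).1.pow 2)).mul (hf y)).congr_deriv (by
      simp only [Pi.neg_apply, Pi.add_apply, Pi.pow_apply]
      push_cast
      ring)
  have hfc : Continuous f := continuous_iff_continuousAt.2 fun y => (hf y).continuousAt
  have hbound : ∀ g : ℝ → ℝ, Continuous g → (∀ y, g (y + 1) = g y) → ∃ C, ∀ y, |g y| ≤ C := by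
    intro g hg hgp
    obtain ⟨C, hC⟩ := exists_bound_of_periodic (F := fun y _ => g y) (by fun_prop)
      (fun y _ => hgp y) 0 0
    exact ⟨C, fun y => hC y 0 (by simp)⟩
  have hc₃ : Continuous fun y => (-deriv (deriv q) y + 3 * q y * deriv q y - q y ^ 3) * f y := by
    fun_prop
  obtain ⟨C₀, hC₀⟩ := hbound f hfc hfper
  obtain ⟨C₁, hC₁⟩ := hbound (fun y => -q y * f y) (by fun_prop)
    (fun y => by simp only [hper, hfper])
  obtain ⟨C₂, hC₂⟩ := hbound (fun y => (-deriv q y + q y ^ 2) * f y) (by fun_prop)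
    (fun y => by simp only [hper, hper₁, hfper])
  obtain ⟨C₃, hC₃⟩ := hbound _ hc₃ (fun y => by simp only [hper, hper₁, hper₂, hfper])
  refine ⟨f, _, _, _, max (max C₀ C₁) (max C₂ C₃), hf, hf₁, hf₂, hc₃, fun y => (hC₀ y).trans ?_,
    fun y => (hC₁ y).trans ?_, fun y => (hC₂ y).trans ?_, fun y => (hC₃ y).trans ?_, hfper,
    fun y => by simp only [hper, hfper], fun y => by simp only [hper, hper₁, hfper],
    fun y => Real.exp_pos _, fun y => rfl⟩ <;> simp

/-- Cole-Hopf regularity: the space derivatives `u_x` and `u_xx` of a solution of Burgers' equation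
are jointly continuous up to the initial and final times. -/
theorem exists_continuous_space_derivs {T : ℝ} (hT : 0 < T) {u : ℝ → ℝ → ℝ}
    (hper : ∀ x t : ℝ, u (x + 1) t = u x t)
    (hx : ∀ t ∈ Icc (0 : ℝ) T, ContDiff ℝ 3 (fun x => u x t))
    (hcont : Continuous fun p : ℝ × ℝ => u p.1 p.2)
    (hburgers : ∀ x : ℝ, ∀ t ∈ Ioo (0 : ℝ) T,
      HasDerivAt (fun s => u x s)
        (deriv (deriv (fun y => u y t)) x - 2 * u x t * deriv (fun y => u y t) x) t) :
    ∃ v w : ℝ → ℝ → ℝ, (Continuous fun p : ℝ × ℝ => v p.1 p.2) ∧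
      (Continuous fun p : ℝ × ℝ => w p.1 p.2) ∧
      (∀ t ∈ Icc 0 T, ∀ x, HasDerivAt (fun y => u y t) (v x t) x) ∧
      (∀ t ∈ Icc 0 T, ∀ x, HasDerivAt (fun y => v y t) (w x t) x) := by
  set m := ∫ y in (0 : ℝ)..1, u y 0 with hm
  have hu₀ : ContDiff ℝ 3 fun x => u x 0 := hx 0 ⟨le_rfl, hT.le⟩
  obtain ⟨f, f₁, f₂, f₃, C, hf, hf₁, hf₂, hf₃, hC, hC₁, hC₂, hC₃, hp, hp₁, hp₂, hpos, hinit⟩ :=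
    exists_coleHopf_initial (q := fun x => u x 0 - m) (hu₀.sub contDiff_const)
      (fun y => by simp only [hper])
      (by
        rw [intervalIntegral.integral_sub (hu₀.continuous.intervalIntegrable _ _) (by simp), ← hm]
        simp)
  have hfc : Continuous f := continuous_iff_continuousAt.2 fun y => (hf y).continuousAt
  have hfc₁ : Continuous f₁ := continuous_iff_continuousAt.2 fun y => (hf₁ y).continuousAt
  have hfc₂ : Continuous f₂ := continuous_iff_continuousAt.2 fun y => (hf₂ y).continuousAt
  have hψper := heatAverage_periodic m hp
  have hψper₁ := heatAverage_periodic m hp₁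
  have hψper₂ := heatAverage_periodic m hp₂
  have hψ₀ := heatAverage_zero m f
  have hψ₁₀ := heatAverage_zero m f₁
  have hψc := continuous_heatAverage m hfc hC
  have hψc₁ := continuous_heatAverage m hfc₁ hC₁
  have hψc₂ := continuous_heatAverage m hfc₂ hC₂
  have hψc₃ := continuous_heatAverage m hf₃ hC₃
  have hψx := hasDerivAt_heatAverage_space m hf hfc₁ hC hC₁
  have hψx₁ := hasDerivAt_heatAverage_space m hf₁ hfc₂ hC₁ hC₂
  have hψx₂ := hasDerivAt_heatAverage_space m hf₂ hf₃ hC₂ hC₃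
  have hψt := fun x t (ht : 0 < t) => hasDerivAt_heatAverage_time m hf hf₁ hfc₂ hC hC₁ hC₂ x ht
  have hψt₁ := fun x t (ht : 0 < t) => hasDerivAt_heatAverage_time m hf₁ hf₂ hf₃ hC₁ hC₂ hC₃ x ht
  have hψpos := heatAverage_pos m hfc hC hpos
  generalize heatAverage m f = ψ at *
  generalize heatAverage m f₁ = ψ₁ at *
  generalize heatAverage m f₂ = ψ₂ at *
  generalize heatAverage m f₃ = ψ₃ at *
  have hne : ∀ x t, ψ x t ≠ 0 := fun x t => (hψpos x t).ne'
  obtain ⟨M, hM⟩ := exists_bound_of_periodic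
    (F := fun x t => 2 * (ψ₂ x t + (u x t - m) * ψ₁ x t) / ψ x t)
    (by fun_prop (disch := intro p; exact hne p.1 p.2))
    (fun x t => by simp only [hψper, hψper₁, hψper₂, hper]) 0 T
  have hux : ∀ x, ∀ t ∈ Ioo 0 T, HasDerivAt (fun y => u y t) (deriv (fun y => u y t) x) x :=
    fun x t ht => (hasDerivAt_deriv_of_contDiff (hx t ⟨ht.1.le, ht.2.le⟩) (by norm_num) x).1
  have huxx : ∀ x, ∀ t ∈ Ioo 0 T, HasDerivAt (fun z => deriv (fun y => u y t) z)
      (deriv (deriv (fun y => u y t)) x) x :=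
    fun x t ht => (hasDerivAt_deriv_of_contDiff (hx t ⟨ht.1.le, ht.2.le⟩) (by norm_num) x).2
  have hWx : ∀ x, ∀ t ∈ Ioo 0 T, HasDerivAt (fun y => ψ₁ y t + (u y t - m) * ψ y t)
      (ψ₂ x t + deriv (fun y => u y t) x * ψ x t + (u x t - m) * ψ₁ x t) x := fun x t ht =>
    ((hψx₁ x t).add (((hux x t ht).sub_const m).mul (hψx x t))).congr_deriv (by ring)
  have hWxx : ∀ x, ∀ t ∈ Ioo 0 T, HasDerivAt
      (fun x => ψ₂ x t + deriv (fun y => u y t) x * ψ x t + (u x t - m) * ψ₁ x t)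
      (ψ₃ x t + deriv (deriv (fun y => u y t)) x * ψ x t + 2 * deriv (fun y => u y t) x * ψ₁ x t
        + (u x t - m) * ψ₂ x t) x := fun x t ht =>
    (((hψx₂ x t).add ((huxx x t ht).mul (hψx x t))).add
      (((hux x t ht).sub_const m).mul (hψx₁ x t))).congr_deriv (by ring)
  have hWt : ∀ x, ∀ t ∈ Ioo 0 T, HasDerivAt (fun s => ψ₁ x s + (u x s - m) * ψ x s)
      (ψ₃ x t - 2 * m * ψ₂ x t +
        (deriv (deriv (fun y => u y t)) x - 2 * u x t * deriv (fun y => u y t) x) * ψ x t +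
        (u x t - m) * (ψ₂ x t - 2 * m * ψ₁ x t)) t := fun x t ht =>
    ((hψt₁ x t ht.1).add (((hburgers x t ht).sub_const m).mul (hψt x t ht.1))).congr_deriv
      (by ring)
  have hcrit : ∀ x, ∀ t ∈ Ioo 0 T,
      ψ₂ x t + deriv (fun y => u y t) x * ψ x t + (u x t - m) * ψ₁ x t = 0 →
      |-2 * deriv (fun y => u y t) x| ≤ M := by
    intro x t ht h
    have hb := hM x t ⟨ht.1.le, ht.2.le⟩
    have heq : 2 * (ψ₂ x t + (u x t - m) * ψ₁ x t) / ψ x t = -2 * deriv (fun y => u y t) x := by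
      rw [div_eq_iff (hne x t)]
      linear_combination 2 * h
    rwa [heq] at hb
  have hW₀ : ∀ x, ψ₁ x 0 + (u x 0 - m) * ψ x 0 = 0 := by
    intro x
    rw [hψ₀, hψ₁₀, hinit]
    ring
  have hWper : ∀ x t, ψ₁ (x + 1) t + (u (x + 1) t - m) * ψ (x + 1) t =
      ψ₁ x t + (u x t - m) * ψ x t := fun x t => by simp only [hψper, hψper₁, hper]
  have hWc : Continuous fun p : ℝ × ℝ => ψ₁ p.1 p.2 + (u p.1 p.2 - m) * ψ p.1 p.2 := by fun_prop
  have hle := parabolic_max_principle hWc hWper (fun x => (hW₀ x).le) hWx hWxx hWt (M := M) (by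
    intro x t ht h0 hpos
    have hb := mul_le_mul_of_nonneg_right ((abs_le.1 (hcrit x t ht h0)).2) hpos.le
    linear_combination hb - 2 * m * h0)
  have hge := parabolic_max_principle
    (W := fun x t => -(ψ₁ x t + (u x t - m) * ψ x t)) hWc.neg
    (fun x t => by rw [hWper]) (fun x => by rw [hW₀ x, neg_zero])
    (fun x t ht => (hWx x t ht).neg) (fun x t ht => (hWxx x t ht).neg)
    (fun x t ht => (hWt x t ht).neg) (M := M) (by
    intro x t ht h0 hpos
    have h0' := neg_eq_zero.1 h0
    have hb := mul_le_mul_of_nonneg_right ((abs_le.1 (hcrit x t ht h0')).2) hpos.le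
    linear_combination hb + 2 * m * h0')
  have hzero : ∀ x, ∀ t ∈ Icc 0 T, ψ₁ x t + (u x t - m) * ψ x t = 0 := by
    intro x t ht
    have hcl : IsClosed {t | ψ₁ x t + (u x t - m) * ψ x t = 0} :=
      isClosed_eq (hWc.comp (Continuous.prodMk_right x)) continuous_const
    have hsub : Ico 0 T ⊆ {t | ψ₁ x t + (u x t - m) * ψ x t = 0} := fun s hs =>
      le_antisymm (hle x s hs) (neg_nonpos.1 (hge x s hs))
    have := hcl.closure_subset_iff.2 hsub
    rw [closure_Ico hT.ne] at this
    exact this ht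
  have hu : ∀ t ∈ Icc 0 T, (fun y => u y t) = fun y => m - ψ₁ y t / ψ y t := by
    intro t ht
    ext y
    have := hne y t
    field_simp
    linear_combination hzero y t ht
  refine ⟨fun x t => -(ψ₂ x t / ψ x t) + (ψ₁ x t / ψ x t) ^ 2,
    fun x t => -((ψ₃ x t * ψ x t - ψ₂ x t * ψ₁ x t) / ψ x t ^ 2) +
      2 * (ψ₁ x t / ψ x t) * ((ψ₂ x t * ψ x t - ψ₁ x t * ψ₁ x t) / ψ x t ^ 2),
    by fun_prop (disch := intro p; exact hne p.1 p.2),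
    by fun_prop (disch := intro p; first | exact hne p.1 p.2 | exact pow_ne_zero 2 (hne p.1 p.2)),
    fun t ht x => ?_, fun t ht x => ?_⟩
  · rw [hu t ht]
    refine (((hψx₁ x t).div (hψx x t) (hne x t)).const_sub m).congr_deriv ?_
    have := hne x t
    field_simp
    ring
  · refine (((hψx₂ x t).div (hψx x t) (hne x t)).neg.add
      (((hψx₁ x t).div (hψx x t) (hne x t)).pow 2)).congr_deriv ?_
    simp

theorem deriv_periodic {f f' : ℝ → ℝ} (hf : ∀ y, HasDerivAt f (f' y) y)
    (hper : ∀ y, f (y + 1) = f y) (y : ℝ) : f' (y + 1) = f' y := by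
  have hd : deriv f = f' := funext fun y => (hf y).deriv
  exact hd ▸ deriv_add_one_of_periodic hper y

theorem integral_periodic_deriv_eq_zero {F F' : ℝ → ℝ} (hF : ∀ y, HasDerivAt F (F' y) y)
    (hF' : Continuous F') (hper : ∀ y, F (y + 1) = F y) :
    ∫ x in (-(1 : ℝ) / 2)..(1 / 2), F' x = 0 := by
  rw [integral_eq_sub_of_hasDerivAt (fun x _ => hF x) (hF'.intervalIntegrable _ _),
    show (1 / 2 : ℝ) = -1 / 2 + 1 by norm_num, hper, sub_self]

/-- Sup bound for the derivative `v` of a periodic function `u`: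
`2 v² ≤ a ∫ v² + a⁻¹ ∫ v_x²` for every `a > 0`. -/
theorem two_mul_sq_le_of_periodic {u v w : ℝ → ℝ} (hu : ∀ y, HasDerivAt u (v y) y)
    (hv : ∀ y, HasDerivAt v (w y) y) (hw : Continuous w) (hper : ∀ y, u (y + 1) = u y)
    {a : ℝ} (ha : 0 < a) (x : ℝ) :
    2 * v x ^ 2 ≤ a * (∫ y in (-(1 : ℝ) / 2)..(1 / 2), v y ^ 2) +
      a⁻¹ * ∫ y in (-(1 : ℝ) / 2)..(1 / 2), w y ^ 2 := by
  have hvper := deriv_periodic hu hper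
  have hwper := deriv_periodic hv hvper
  have hvc : Continuous v := continuous_iff_continuousAt.2 fun y => (hv y).continuousAt
  obtain ⟨z, hz, hvz⟩ := exists_hasDerivAt_eq_zero (f := u) (f' := v) (lt_add_one x)
    (continuous_iff_continuousAt.2 fun y => (hu y).continuousAt).continuousOn (hper x).symm
    (fun y _ => hu y)
  have hsq : ∀ y, HasDerivAt (fun y => v y ^ 2) (2 * v y * w y) y := fun y =>
    ((hv y).pow 2).congr_deriv (by push_cast; ring)
  have hi : ∀ b c, IntervalIntegrable (fun y => 2 * v y * w y) volume b c := fun b c =>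
    (by fun_prop : Continuous fun y => 2 * v y * w y).intervalIntegrable b c
  have hg : Continuous fun y => a * v y ^ 2 + a⁻¹ * w y ^ 2 := by fun_prop
  have hpt : ∀ y, |2 * v y * w y| ≤ a * v y ^ 2 + a⁻¹ * w y ^ 2 := by
    intro y
    have h1 : a * v y ^ 2 + a⁻¹ * w y ^ 2 - 2 * v y * w y = a⁻¹ * (a * v y - w y) ^ 2 := by
      field_simp
      ring
    have h2 : a * v y ^ 2 + a⁻¹ * w y ^ 2 + 2 * v y * w y = a⁻¹ * (a * v y + w y) ^ 2 := by
      field_simp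
      ring
    have h3 : 0 ≤ a⁻¹ * (a * v y - w y) ^ 2 := by positivity
    have h4 : 0 ≤ a⁻¹ * (a * v y + w y) ^ 2 := by positivity
    rw [abs_le]
    constructor <;> linarith
  have hL : v x ^ 2 ≤ ∫ y in x..z, (a * v y ^ 2 + a⁻¹ * w y ^ 2) := by
    have h := integral_eq_sub_of_hasDerivAt (fun y _ => hsq y) (hi x z)
    have h' := integral_mono_on hz.1.le (hi x z).neg (hg.intervalIntegrable x z)
      (fun y _ => (neg_le_abs _).trans (hpt y))
    simp only [Pi.neg_apply, intervalIntegral.integral_neg] at h'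
    rw [h, hvz] at h'
    linarith
  have hR : v x ^ 2 ≤ ∫ y in z..(x + 1), (a * v y ^ 2 + a⁻¹ * w y ^ 2) := by
    have h := integral_eq_sub_of_hasDerivAt (fun y _ => hsq y) (hi z (x + 1))
    have h' := integral_mono_on hz.2.le (hi z (x + 1)) (hg.intervalIntegrable z (x + 1))
      (fun y _ => (le_abs_self _).trans (hpt y))
    rw [h, hvz, hvper] at h'
    linarith
  have hgper : Function.Periodic (fun y => a * v y ^ 2 + a⁻¹ * w y ^ 2) 1 := fun y => by
    simp only [hvper, hwper]
  have hshift := hgper.intervalIntegral_add_eq x (-(1 : ℝ) / 2)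
  rw [show -(1 : ℝ) / 2 + 1 = 1 / 2 by norm_num] at hshift
  have hsplit := integral_add_adjacent_intervals (hg.intervalIntegrable (μ := volume) x z)
    (hg.intervalIntegrable z (x + 1))
  rw [← intervalIntegral.integral_const_mul, ← intervalIntegral.integral_const_mul,
    ← intervalIntegral.integral_add
      ((by fun_prop : Continuous fun y => a * v y ^ 2).intervalIntegrable _ _)
      ((by fun_prop : Continuous fun y => a⁻¹ * w y ^ 2).intervalIntegrable _ _), ← hshift,
    ← hsplit]
  linarith

/-- The instantaneous enstrophy growth bound `R ≤ (3/2) E^{5/3}`, with `E = e³`. -/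
theorem enstrophy_rate_le {u v w : ℝ → ℝ} (hu : ∀ y, HasDerivAt u (v y) y)
    (hv : ∀ y, HasDerivAt v (w y) y) (hw : Continuous w) (hper : ∀ y, u (y + 1) = u y)
    {e : ℝ} (he : 0 < e)
    (hE : (1 / 2) * ∫ x in (-(1 : ℝ) / 2)..(1 / 2), v x ^ 2 = e ^ 3) :
    -∫ x in (-(1 : ℝ) / 2)..(1 / 2), (w x ^ 2 + v x ^ 3) ≤ 3 / 2 * e ^ 5 := by
  have hvc : Continuous v := continuous_iff_continuousAt.2 fun y => (hv y).continuousAt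
  set p := ∫ x in (-(1 : ℝ) / 2)..(1 / 2), w x ^ 2 with hp
  have hpt : ∀ x, -v x ^ 3 ≤ (3 * e ^ 2 / 4 + p / (2 * e ^ 3)) * v x ^ 2 := by
    intro x
    have h := two_mul_sq_le_of_periodic hu hv hw hper (half_pos he) x
    rw [← hp, show (∫ y in (-(1 : ℝ) / 2)..(1 / 2), v y ^ 2) = 2 * e ^ 3 by linarith] at h
    have h1 : v x ^ 2 ≤ e ^ 4 / 2 + p / e := by
      have : e / 2 * (2 * e ^ 3) + (e / 2)⁻¹ * p = 2 * (e ^ 4 / 2 + p / e) := by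
        field_simp
      linarith
    have h2 : -v x ≤ 3 * e ^ 2 / 4 + p / (2 * e ^ 3) := by
      have h3 : -v x * (2 * e ^ 2) ≤ v x ^ 2 + e ^ 4 := by
        nlinarith [sq_nonneg (v x + e ^ 2)]
      have h4 : (3 * e ^ 2 / 4 + p / (2 * e ^ 3)) * (2 * e ^ 2) =
          e ^ 4 / 2 + p / e + e ^ 4 := by
        field_simp
        ring
      refine le_of_mul_le_mul_right ?_ (by positivity : 0 < 2 * e ^ 2)
      linarith
    have := mul_le_mul_of_nonneg_right h2 (sq_nonneg (v x))
    linarith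
  have hmono := integral_mono (μ := volume) (by norm_num : (-(1 : ℝ) / 2) ≤ 1 / 2)
    ((by fun_prop : Continuous fun x => -v x ^ 3).intervalIntegrable _ _)
    ((by fun_prop : Continuous fun x =>
      (3 * e ^ 2 / 4 + p / (2 * e ^ 3)) * v x ^ 2).intervalIntegrable _ _) hpt
  rw [intervalIntegral.integral_const_mul, intervalIntegral.integral_neg,
    show (∫ y in (-(1 : ℝ) / 2)..(1 / 2), v y ^ 2) = 2 * e ^ 3 by linarith] at hmono
  rw [intervalIntegral.integral_add
    ((by fun_prop : Continuous fun x => w x ^ 2).intervalIntegrable _ _)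
    ((by fun_prop : Continuous fun x => v x ^ 3).intervalIntegrable _ _), ← hp]
  have : (3 * e ^ 2 / 4 + p / (2 * e ^ 3)) * (2 * e ^ 3) = 3 / 2 * e ^ 5 + p := by
    field_simp
    ring
  linarith

/-- Differentiation in time of `s ↦ ∫ (u(x,s) - u(x,t)) g(x,s) dx` at `s = t`, where `g` need only
be continuous. -/
theorem hasDerivAt_integral_sub_mul {T : ℝ} {u d g : ℝ → ℝ → ℝ}
    (hd : Continuous fun p : ℝ × ℝ => d p.1 p.2) (hg : Continuous fun p : ℝ × ℝ => g p.1 p.2)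
    (hu : ∀ x, ∀ t ∈ Ioo 0 T, HasDerivAt (fun s => u x s) (d x t) t) (a b : ℝ) {t : ℝ}
    (ht : t ∈ Ioo 0 T) :
    HasDerivAt (fun s => ∫ x in a..b, (u x s - u x t) * g x s) (∫ x in a..b, d x t * g x t) t := by
  set Q : ℝ → ℝ → ℝ := fun x s => ∫ θ in (0 : ℝ)..1, d x (t + (s - t) * θ) with hQ
  have hQc : Continuous fun p : ℝ × ℝ => Q p.1 p.2 :=
    continuous_parametric_intervalIntegral_of_continuous'
      (f := fun (p : ℝ × ℝ) θ => d p.1 (t + (p.2 - t) * θ))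
      (hd.comp (by fun_prop : Continuous fun q : (ℝ × ℝ) × ℝ =>
        (q.1.1, t + (q.1.2 - t) * q.2))) 0 1
  have hQt : ∀ x, Q x t = d x t := fun x => by simp [hQ]
  have hHc : Continuous fun s => ∫ x in a..b, Q x s * g x s :=
    continuous_parametric_intervalIntegral_of_continuous'
      (f := fun s x => Q x s * g x s)
      ((hQc.mul hg).comp (by fun_prop : Continuous fun q : ℝ × ℝ => (q.2, q.1))) a b
  have hsub : ∀ x, ∀ s ∈ Ioo 0 T, u x s - u x t = (s - t) * Q x s := by
    intro x s hs
    have hmem : ∀ θ ∈ uIcc (0 : ℝ) 1, t + (s - t) * θ ∈ Ioo 0 T := by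
      intro θ hθ
      rw [uIcc_of_le zero_le_one] at hθ
      have h := (convex_Ioo (0 : ℝ) T).add_smul_sub_mem ht hs hθ
      simpa [mul_comm] using h
    have h := integral_eq_sub_of_hasDerivAt (a := 0) (b := 1)
      (f := fun θ => u x (t + (s - t) * θ)) (f' := fun θ => d x (t + (s - t) * θ) * (s - t))
      (fun θ hθ => by
        have := (hu x _ (hmem θ hθ)).comp θ
          (((hasDerivAt_id θ).const_mul (s - t)).const_add t)
        exact this.congr_deriv (by simp))
      (((hd.comp (by fun_prop : Continuous fun θ : ℝ => (x, t + (s - t) * θ))).mul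
        continuous_const).intervalIntegrable _ _)
    rw [intervalIntegral.integral_mul_const] at h
    simp only [mul_one, add_sub_cancel, mul_zero, add_zero] at h
    rw [← h, mul_comm]
  rw [hasDerivAt_iff_tendsto_slope]
  have hlim : Filter.Tendsto (fun s => ∫ x in a..b, Q x s * g x s) (nhdsWithin t {t}ᶜ)
      (nhds (∫ x in a..b, d x t * g x t)) := by
    have := hHc.tendsto t
    simp only [hQt] at this
    exact this.mono_left nhdsWithin_le_nhds
  refine hlim.congr' ?_
  filter_upwards [self_mem_nhdsWithin, mem_nhdsWithin_of_mem_nhds (Ioo_mem_nhds ht.1 ht.2)]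
    with s hne hs
  have hne' : s - t ≠ 0 := sub_ne_zero.2 hne
  rw [slope_def_field]
  simp only [hsub _ s hs, sub_self, zero_mul, intervalIntegral.integral_zero, sub_zero]
  simp only [mul_assoc, intervalIntegral.integral_const_mul]
  field_simp

theorem continuous_integral_sq {v : ℝ → ℝ → ℝ} (hv : Continuous fun p : ℝ × ℝ => v p.1 p.2)
    (a b : ℝ) : Continuous fun t => ∫ x in a..b, v x t ^ 2 :=
  continuous_parametric_intervalIntegral_of_continuous' (f := fun t x => v x t ^ 2)
    ((continuous_pow 2).comp (hv.comp continuous_swap)) a b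

/-- The energy balance `dK/dt = -2E`. -/
theorem hasDerivAt_energy {T : ℝ} {u v w : ℝ → ℝ → ℝ} (hper : ∀ x t : ℝ, u (x + 1) t = u x t)
    (hu : Continuous fun p : ℝ × ℝ => u p.1 p.2)
    (hv : Continuous fun p : ℝ × ℝ => v p.1 p.2)
    (hw : Continuous fun p : ℝ × ℝ => w p.1 p.2)
    (hux : ∀ t ∈ Icc 0 T, ∀ x, HasDerivAt (fun y => u y t) (v x t) x)
    (hvx : ∀ t ∈ Icc 0 T, ∀ x, HasDerivAt (fun y => v y t) (w x t) x)
    (hut : ∀ x, ∀ t ∈ Ioo 0 T, HasDerivAt (fun s => u x s) (w x t - 2 * u x t * v x t) t)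
    {t : ℝ} (ht : t ∈ Ioo 0 T) :
    HasDerivAt (fun s => (1 / 2) * ∫ x in (-(1 : ℝ) / 2)..(1 / 2), u x s ^ 2)
      (-∫ x in (-(1 : ℝ) / 2)..(1 / 2), v x t ^ 2) t := by
  have ht' : t ∈ Icc 0 T := ⟨ht.1.le, ht.2.le⟩
  have hut_c : Continuous fun x => u x t := hu.comp (Continuous.prodMk_left t)
  have hvt_c : Continuous fun x => v x t := hv.comp (Continuous.prodMk_left t)
  have hwt_c : Continuous fun x => w x t := hw.comp (Continuous.prodMk_left t)
  have h := (hasDerivAt_integral_sub_mul (T := T) (u := u)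
    (d := fun x t => w x t - 2 * u x t * v x t)
    (g := fun x s => (1 / 2) * (u x s + u x t)) (by fun_prop)
    ((hu.add (hut_c.comp continuous_fst)).const_mul _) hut (-(1 : ℝ) / 2) (1 / 2) ht).add_const
    ((1 / 2) * ∫ x in (-(1 : ℝ) / 2)..(1 / 2), u x t ^ 2)
  have hzero := integral_periodic_deriv_eq_zero
    (F := fun x => u x t * v x t - 2 / 3 * u x t ^ 3)
    (F' := fun x => v x t ^ 2 + (w x t - 2 * u x t * v x t) * ((1 / 2) * (u x t + u x t)))
    (fun x => (((hux t ht' x).mul (hvx t ht' x)).sub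
      (((hux t ht' x).pow 3).const_mul (2 / 3))).congr_deriv (by push_cast; ring))
    (by fun_prop)
    (fun y => by simp only [hper, deriv_periodic (hux t ht') (fun y => hper y t)])
  rw [intervalIntegral.integral_add
    ((by fun_prop : Continuous fun x => v x t ^ 2).intervalIntegrable _ _)
    ((by fun_prop : Continuous fun x =>
      (w x t - 2 * u x t * v x t) * ((1 / 2) * (u x t + u x t))).intervalIntegrable _ _)] at hzero
  refine (h.congr_deriv (by linarith)).congr_of_eventuallyEq
    (Filter.Eventually.of_forall fun s => ?_)
  have hus_c : Continuous fun x => u x s := hu.comp (Continuous.prodMk_left s)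
  simp only
  rw [← intervalIntegral.integral_const_mul, ← intervalIntegral.integral_const_mul,
    ← intervalIntegral.integral_add
    ((by fun_prop : Continuous fun x =>
      (u x s - u x t) * ((1 / 2) * (u x s + u x t))).intervalIntegrable _ _)
    ((by fun_prop : Continuous fun x => 1 / 2 * u x t ^ 2).intervalIntegrable _ _)]
  congr 1
  ext x
  ring

/-- The enstrophy balance `dE/dt = R`. -/
theorem hasDerivAt_enstrophy {T : ℝ} {u v w : ℝ → ℝ → ℝ} (hper : ∀ x t : ℝ, u (x + 1) t = u x t)
    (hu : Continuous fun p : ℝ × ℝ => u p.1 p.2)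
    (hv : Continuous fun p : ℝ × ℝ => v p.1 p.2)
    (hw : Continuous fun p : ℝ × ℝ => w p.1 p.2)
    (hux : ∀ t ∈ Icc 0 T, ∀ x, HasDerivAt (fun y => u y t) (v x t) x)
    (hvx : ∀ t ∈ Icc 0 T, ∀ x, HasDerivAt (fun y => v y t) (w x t) x)
    (hut : ∀ x, ∀ t ∈ Ioo 0 T, HasDerivAt (fun s => u x s) (w x t - 2 * u x t * v x t) t)
    {t : ℝ} (ht : t ∈ Ioo 0 T) :
    HasDerivAt (fun s => (1 / 2) * ∫ x in (-(1 : ℝ) / 2)..(1 / 2), v x s ^ 2)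
      (-∫ x in (-(1 : ℝ) / 2)..(1 / 2), (w x t ^ 2 + v x t ^ 3)) t := by
  have ht' : t ∈ Icc 0 T := ⟨ht.1.le, ht.2.le⟩
  have hut_c : Continuous fun x => u x t := hu.comp (Continuous.prodMk_left t)
  have hvt_c : Continuous fun x => v x t := hv.comp (Continuous.prodMk_left t)
  have hwt_c : Continuous fun x => w x t := hw.comp (Continuous.prodMk_left t)
  have h := (hasDerivAt_integral_sub_mul (T := T) (u := u)
    (d := fun x t => w x t - 2 * u x t * v x t)
    (g := fun x s => -(1 / 2) * (w x s + w x t)) (by fun_prop)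
    ((hw.add (hwt_c.comp continuous_fst)).const_mul _) hut (-(1 : ℝ) / 2) (1 / 2) ht).add_const
    ((1 / 2) * ∫ x in (-(1 : ℝ) / 2)..(1 / 2), v x t ^ 2)
  have hzero := integral_periodic_deriv_eq_zero
    (F := fun x => u x t * v x t ^ 2)
    (F' := fun x => (w x t ^ 2 + v x t ^ 3) +
      (w x t - 2 * u x t * v x t) * (-(1 / 2) * (w x t + w x t)))
    (fun x => ((hux t ht' x).mul ((hvx t ht' x).pow 2)).congr_deriv (by
      simp only [Pi.pow_apply]
      push_cast
      ring))
    (by fun_prop)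
    (fun y => by simp only [hper, deriv_periodic (hux t ht') (fun y => hper y t)])
  rw [intervalIntegral.integral_add
    ((by fun_prop : Continuous fun x => w x t ^ 2 + v x t ^ 3).intervalIntegrable _ _)
    ((by fun_prop : Continuous fun x => (w x t - 2 * u x t * v x t) *
      (-(1 / 2) * (w x t + w x t))).intervalIntegrable _ _)] at hzero
  refine (h.congr_deriv (by linarith)).congr_of_eventuallyEq ?_
  filter_upwards [Ioo_mem_nhds ht.1 ht.2] with s hs
  have hs' : s ∈ Icc 0 T := ⟨hs.1.le, hs.2.le⟩
  have hus_c : Continuous fun x => u x s := hu.comp (Continuous.prodMk_left s)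
  have hvs_c : Continuous fun x => v x s := hv.comp (Continuous.prodMk_left s)
  have hws_c : Continuous fun x => w x s := hw.comp (Continuous.prodMk_left s)
  have hparts := integral_periodic_deriv_eq_zero
    (F := fun x => (1 / 2) * ((u x s - u x t) * (v x s + v x t)))
    (F' := fun x => (1 / 2) * ((v x s - v x t) * (v x s + v x t) +
      (u x s - u x t) * (w x s + w x t)))
    (fun x => (((hux s hs' x).sub (hux t ht' x)).mul
      ((hvx s hs' x).add (hvx t ht' x))).const_mul (1 / 2)) (by fun_prop)
    (fun y => by simp only [hper, deriv_periodic (hux t ht') (fun y => hper y t),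
      deriv_periodic (hux s hs') (fun y => hper y s)])
  rw [← sub_eq_zero, ← intervalIntegral.integral_const_mul, ← intervalIntegral.integral_const_mul,
    ← intervalIntegral.integral_add
    ((by fun_prop : Continuous fun x =>
      (u x s - u x t) * (-(1 / 2) * (w x s + w x t))).intervalIntegrable _ _)
    ((by fun_prop : Continuous fun x => 1 / 2 * v x t ^ 2).intervalIntegrable _ _),
    ← intervalIntegral.integral_sub
    ((by fun_prop : Continuous fun x => 1 / 2 * v x s ^ 2).intervalIntegrable _ _)
    ((by fun_prop : Continuous fun x =>
      (u x s - u x t) * (-(1 / 2) * (w x s + w x t)) + 1 / 2 * v x t ^ 2).intervalIntegrable _ _),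
    ← hparts]
  congr 1
  ext x
  ring

/-- Integrated enstrophy bound for the viscous Burgers equation on the unit circle:
`E(T)^{1/3} - E(0)^{1/3} ≤ (1/2)∫₀^T E(t) dt = (1/4)(K(0) - K(T))`. -/
theorem enstrophy_integrated_bound (T : ℝ) (hT : 0 < T) (u : ℝ → ℝ → ℝ)
    (hper : ∀ x t : ℝ, u (x + 1) t = u x t)
    (hx : ∀ t ∈ Set.Icc (0:ℝ) T, ContDiff ℝ 3 (fun x => u x t))
    (hcont : Continuous fun p : ℝ × ℝ => u p.1 p.2)
    (hburgers : ∀ x : ℝ, ∀ t ∈ Set.Ioo (0:ℝ) T,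
      HasDerivAt (fun s => u x s)
        (deriv (deriv (fun y => u y t)) x - 2 * u x t * deriv (fun y => u y t) x) t)
    (hEpos : ∀ t ∈ Set.Icc (0:ℝ) T,
      0 < (1/2) * ∫ x in (-(1:ℝ)/2)..(1/2), (deriv (fun y => u y t) x) ^ 2) :
    ((1/2) * ∫ x in (-(1:ℝ)/2)..(1/2), (deriv (fun y => u y T) x) ^ 2) ^ ((1:ℝ)/3) -
      ((1/2) * ∫ x in (-(1:ℝ)/2)..(1/2), (deriv (fun y => u y 0) x) ^ 2) ^ ((1:ℝ)/3) ≤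
      (1/2) * ∫ t in (0:ℝ)..T, ((1/2) * ∫ x in (-(1:ℝ)/2)..(1/2), (deriv (fun y => u y t) x) ^ 2) ∧
    (1/2) * (∫ t in (0:ℝ)..T, ((1/2) * ∫ x in (-(1:ℝ)/2)..(1/2), (deriv (fun y => u y t) x) ^ 2)) =
      (1/4) * (((1/2) * ∫ x in (-(1:ℝ)/2)..(1/2), (u x 0) ^ 2) -
               ((1/2) * ∫ x in (-(1:ℝ)/2)..(1/2), (u x T) ^ 2)) := by
  obtain ⟨v, w, hv, hw, hux, hvx⟩ := exists_continuous_space_derivs hT hper hx hcont hburgers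
  have hdu : ∀ t ∈ Icc 0 T, deriv (fun y => u y t) = fun y => v y t := fun t ht =>
    funext fun y => (hux t ht y).deriv
  have hut : ∀ x, ∀ t ∈ Ioo 0 T, HasDerivAt (fun s => u x s) (w x t - 2 * u x t * v x t) t := by
    intro x t ht
    have ht' : t ∈ Icc 0 T := ⟨ht.1.le, ht.2.le⟩
    have h := hburgers x t ht
    rwa [hdu t ht', (hvx t ht' x).deriv] at h
  set E : ℝ → ℝ := fun t => (1 / 2) * ∫ x in (-(1 : ℝ) / 2)..(1 / 2), v x t ^ 2 with hE
  have hEeq : ∀ t ∈ Icc 0 T,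
      (1 / 2) * ∫ x in (-(1 : ℝ) / 2)..(1 / 2), (deriv (fun y => u y t) x) ^ 2 = E t :=
    fun t ht => by rw [hdu t ht]
  have hEc : Continuous E := (continuous_integral_sq hv _ _).const_mul _
  have hKc : Continuous fun t => (1 / 2) * ∫ x in (-(1 : ℝ) / 2)..(1 / 2), u x t ^ 2 :=
    (continuous_integral_sq hcont _ _).const_mul _
  have hpos : ∀ t ∈ Icc 0 T, 0 < E t := fun t ht => hEeq t ht ▸ hEpos t ht
  have hint : ∫ t in (0 : ℝ)..T,
      ((1 / 2) * ∫ x in (-(1 : ℝ) / 2)..(1 / 2), (deriv (fun y => u y t) x) ^ 2) =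
      ∫ t in (0 : ℝ)..T, E t :=
    intervalIntegral.integral_congr fun t ht => hEeq t (by rwa [uIcc_of_le hT.le] at ht)
  rw [hint, hEeq T ⟨hT.le, le_rfl⟩, hEeq 0 ⟨le_rfl, hT.le⟩]
  constructor
  · rw [← intervalIntegral.integral_const_mul]
    refine sub_le_integral_of_hasDeriv_right_of_le (g := fun t => E t ^ ((1 : ℝ) / 3)) hT.le
      (hEc.continuousOn.rpow_const fun t ht => Or.inl (hpos t ht).ne')
      (fun t ht => (((hasDerivAt_enstrophy hper hcont hv hw hux hvx hut ht).rpow_const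
        (Or.inl (hpos t ⟨ht.1.le, ht.2.le⟩).ne')).hasDerivWithinAt))
      ((by fun_prop : Continuous fun t => 1 / 2 * E t).continuousOn.integrableOn_Icc) ?_
    intro t ht
    have ht' : t ∈ Icc 0 T := ⟨ht.1.le, ht.2.le⟩
    have hp := hpos t ht'
    have he : 0 < E t ^ ((1 : ℝ) / 3) := Real.rpow_pos_of_pos hp _
    have he3 : E t = (E t ^ ((1 : ℝ) / 3)) ^ 3 := by
      rw [← Real.rpow_natCast, ← Real.rpow_mul hp.le]
      norm_num
    have hrate := enstrophy_rate_le (hux t ht') (hvx t ht')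
      (hw.comp (Continuous.prodMk_left t)) (fun y => hper y t) he he3
    have hexp : E t ^ ((1 : ℝ) / 3 - 1) = ((E t ^ ((1 : ℝ) / 3)) ^ 2)⁻¹ := by
      rw [← Real.rpow_natCast, ← Real.rpow_mul hp.le, ← Real.rpow_neg hp.le]
      norm_num
    change _ * (1 / 3) * E t ^ ((1 : ℝ) / 3 - 1) ≤ 1 / 2 * E t
    rw [hexp]
    generalize E t ^ ((1 : ℝ) / 3) = e at *
    rw [he3, ← div_eq_mul_inv, div_le_iff₀ (by positivity)]
    linarith
  · have h := integral_eq_sub_of_hasDerivAt_of_le hT.le hKc.continuousOn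
      (fun t ht => hasDerivAt_energy hper hcont hv hw hux hvx hut ht)
      ((continuous_integral_sq hv _ _).neg.intervalIntegrable _ _)
    rw [intervalIntegral.integral_neg] at h
    simp only [hE]
    rw [intervalIntegral.integral_const_mul]
    linarith
end
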